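/- For every ξ ∈ 𝒜₁ ∪ 𝒜₂ ∪ 𝒜₃, the function G is differentiable at ξ, and its Fréchet derivative satisfies DG(ξ)η = 𝒢(ξ,η) for every η ∈ 𝕄²ˣ²_sym. -/

import Mathlib

open Matrix Set
open scoped Classical

attribute [local instance] Matrix.frobeniusNormedAddCommGroup Matrix.frobeniusNormedSpace

noncomputable section

/-- The space of real 2×2 matrices (symmetric ones are singled out by `Matrix.IsSymm`). -/
abbrev M2 : Type := Matrix (Fin 2) (Fin 2) ℝ

/-- Frobenius inner product `A : B = tr (Aᵀ B)`. -/
def inn (A B : M2) : ℝ := (Aᵀ * B).trace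

/-- Frobenius norm `|A| = √(A : A)`. -/
def fnorm (A : M2) : ℝ := Real.sqrt (inn A A)

/-- Deviatoric part `A_D = A − (tr A / 2) Id`. -/
def dev (A : M2) : M2 := A - (A.trace / 2) • (1 : M2)

/-- The set of symmetric matrices `𝕄²ˣ²_sym`. -/
def Msym : Set M2 := {A | A.IsSymm}

/-- The Drucker–Prager elasticity set `K = {σ ∈ 𝕄²ˣ²_sym : |σ_D| + α tr σ ≤ κ}`. -/
def Kset (α κ : ℝ) : Set M2 :=
  {σ | σ.IsSymm ∧ fnorm (dev σ) + α * σ.trace ≤ κ}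

/-- The isotropic elasticity tensor `ℂ e = λ (tr e) Id + 2 μ e`. -/
def Cc (lam mu : ℝ) (e : M2) : M2 := (lam * e.trace) • (1 : M2) + (2 * mu) • e

/-- The inverse elasticity tensor `ℂ⁻¹ σ = (tr σ / (4 K₀)) Id + (1/(2μ)) σ_D`, `K₀ = λ + μ`. -/
def Cinv (lam mu : ℝ) (σ : M2) : M2 :=
  (σ.trace / (4 * (lam + mu))) • (1 : M2) + (1 / (2 * mu)) • dev σ

/-- The constant `β = (1/μ + 1/(2 α² K₀))⁻¹`. -/
def betaC (α lam mu : ℝ) : ℝ := (1 / mu + 1 / (2 * α ^ 2 * (lam + mu)))⁻¹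

/-- The function `g`. -/
def gfun (α κ lam mu : ℝ) (ξ : M2) : ℝ :=
  if 2 * mu * fnorm (dev ξ) + 2 * α * (lam + mu) * ξ.trace ≤ κ then
    ((lam + mu) / 2) * ξ.trace ^ 2 + mu * fnorm (dev ξ) ^ 2
  else
    κ * ξ.trace / (2 * α) - κ ^ 2 / (8 * α ^ 2 * (lam + mu)) +
      betaC α lam mu *
        max (fnorm (dev ξ) - ξ.trace / (2 * α) + κ / (4 * α ^ 2 * (lam + mu))) 0 ^ 2

/-- The (matrix representing the) differential of `g`. -/
def Dg (α κ lam mu : ℝ) (ξ : M2) : M2 :=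
  if 2 * mu * fnorm (dev ξ) + 2 * α * (lam + mu) * ξ.trace ≤ κ then
    ((lam + mu) * ξ.trace) • (1 : M2) + (2 * mu) • dev ξ
  else
    (κ / (2 * α)) • (1 : M2) +
      (2 * betaC α lam mu *
          max (fnorm (dev ξ) - ξ.trace / (2 * α) + κ / (4 * α ^ 2 * (lam + mu))) 0) •
        ((fnorm (dev ξ))⁻¹ • dev ξ - (1 / (2 * α)) • (1 : M2))

/-- The open cone `𝒜₁ = {ξ ∈ 𝕄²ˣ²_sym : μ |ξ_D| + α K₀ tr ξ < 0}`. -/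
def A1 (α lam mu : ℝ) : Set M2 :=
  {ξ | ξ.IsSymm ∧ mu * fnorm (dev ξ) + α * (lam + mu) * ξ.trace < 0}

/-- The open cone `𝒜₂ = {ξ ∈ 𝕄²ˣ²_sym : |ξ_D| < tr ξ / (2α)}`. -/
def A2 (α : ℝ) : Set M2 :=
  {ξ | ξ.IsSymm ∧ fnorm (dev ξ) < ξ.trace / (2 * α)}

/-- The cone `𝒜₃ = 𝕄²ˣ²_sym ∖ (cl 𝒜₁ ∪ cl 𝒜₂)`. -/
def A3 (α lam mu : ℝ) : Set M2 :=
  Msym \ (closure (A1 α lam mu) ∪ closure (A2 α))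

/-- The function `G(ξ) = Dg(ξ + (κ/(4αK₀)) Id)`, given by its explicit piecewise expression. -/
def Gfun (α κ lam mu : ℝ) (ξ : M2) : M2 :=
  if ξ ∈ A1 α lam mu then
    (κ / (2 * α)) • (1 : M2) + ((lam + mu) * ξ.trace) • (1 : M2) + (2 * mu) • dev ξ
  else if ξ ∈ A2 α ∨ ξ = 0 then
    (κ / (2 * α)) • (1 : M2)
  else
    (κ / (2 * α)) • (1 : M2) +
      (2 * betaC α lam mu * (fnorm (dev ξ) - ξ.trace / (2 * α))) •
        ((fnorm (dev ξ))⁻¹ • dev ξ - (1 / (2 * α)) • (1 : M2))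

/-- The map `𝒢(ξ, η)`. -/
def calG (α lam mu : ℝ) (ξ η : M2) : M2 :=
  if ξ ∈ A1 α lam mu then
    ((lam + mu) * η.trace) • (1 : M2) + (2 * mu) • dev η
  else if ξ ∈ A2 α ∨ ξ = 0 then
    0
  else
    (2 * betaC α lam mu * (inn (dev ξ) (dev η) / fnorm (dev ξ) - η.trace / (2 * α))) •
      ((fnorm (dev ξ))⁻¹ • dev ξ - (1 / (2 * α)) • (1 : M2)) +
    (2 * betaC α lam mu * (fnorm (dev ξ) - ξ.trace / (2 * α)) * (fnorm (dev ξ))⁻¹) •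
      (dev η - (inn (dev ξ) (dev η) / fnorm (dev ξ) ^ 2) • dev ξ)

/-- The relative boundary `∂𝒜₁` of `𝒜₁` inside `𝕄²ˣ²_sym`. -/
def bdryA1 (α lam mu : ℝ) : Set M2 := closure (A1 α lam mu) \ A1 α lam mu

/-- The relative boundary `∂𝒜₂` of `𝒜₂` inside `𝕄²ˣ²_sym`. -/
def bdryA2 (α : ℝ) : Set M2 := closure (A2 α) \ A2 α

/-- The outward normal `ν(σ) = μ σ_D/|σ_D| + α K₀ Id` for `σ ∈ ∂𝒜₁ ∖ {0}`. -/
def nu1 (α lam mu : ℝ) (σ : M2) : M2 :=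
  (mu * (fnorm (dev σ))⁻¹) • dev σ + (α * (lam + mu)) • (1 : M2)

/-- The outward normal `ν(σ) = σ_D/|σ_D| − (1/(2α)) Id` for `σ ∈ ∂𝒜₂ ∖ {0}`. -/
def nu2 (α : ℝ) (σ : M2) : M2 :=
  (fnorm (dev σ))⁻¹ • dev σ - (1 / (2 * α)) • (1 : M2)

/-- The trace as a continuous linear map. -/
def traceL : M2 →L[ℝ] ℝ := LinearMap.toContinuousLinearMap (Matrix.traceLinearMap (Fin 2) ℝ ℝ)

/-- The deviatoric part as a continuous linear map. -/
def devL : M2 →L[ℝ] M2 :=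
  ContinuousLinearMap.id ℝ M2 - ((1 / 2 : ℝ) • traceL).smulRight (1 : M2)

/-- The Frobenius inner product with a fixed matrix as a continuous linear map. -/
def innL (A : M2) : M2 →L[ℝ] ℝ :=
  LinearMap.toContinuousLinearMap
    ((Matrix.traceLinearMap (Fin 2) ℝ ℝ).comp (LinearMap.mulLeft ℝ Aᵀ))

@[simp] lemma traceL_apply (A : M2) : traceL A = A.trace := rfl

@[simp] lemma innL_apply (A B : M2) : innL A B = inn A B := rfl

@[simp] lemma devL_apply (A : M2) : devL A = dev A := by
  simp [devL, dev, div_eq_inv_mul]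

/-- The entry `(i, j)` as a continuous linear map. -/
def entryL (i j : Fin 2) : M2 →L[ℝ] ℝ :=
  LinearMap.toContinuousLinearMap (Matrix.entryLinearMap ℝ ℝ i j)

lemma inn_eq_sum (A B : M2) :
    inn A B = A 0 0 * B 0 0 + A 1 0 * B 1 0 + (A 0 1 * B 0 1 + A 1 1 * B 1 1) := by
  simp [inn, Matrix.trace, Matrix.mul_apply, Fin.sum_univ_two]

lemma inn_self_nonneg (A : M2) : 0 ≤ inn A A := by
  rw [inn_eq_sum]
  nlinarith [sq_nonneg (A 0 0), sq_nonneg (A 1 0), sq_nonneg (A 0 1), sq_nonneg (A 1 1)]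

lemma inn_self_pos {A : M2} (hA : A ≠ 0) : 0 < inn A A := by
  refine (inn_self_nonneg A).lt_of_ne fun h => hA ?_
  rw [inn_eq_sum] at h
  ext i j
  fin_cases i <;> fin_cases j <;> simp <;>
    nlinarith [sq_nonneg (A 0 0), sq_nonneg (A 1 0), sq_nonneg (A 0 1), sq_nonneg (A 1 1)]

lemma fnorm_nonneg (A : M2) : 0 ≤ fnorm A := Real.sqrt_nonneg _

lemma fnorm_pos {A : M2} (hA : A ≠ 0) : 0 < fnorm A := Real.sqrt_pos.2 (inn_self_pos hA)

lemma hasFDerivAt_inn_self (A : M2) :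
    HasFDerivAt (fun B : M2 => inn B B) ((2 : ℝ) • innL A) A := by
  have h (i j : Fin 2) := ((entryL i j).hasFDerivAt (x := A)).mul (entryL i j).hasFDerivAt
  refine ((((h 0 0).add (h 1 0)).add ((h 0 1).add (h 1 1))).congr_fderiv ?_).congr_of_eventuallyEq
    (.of_forall fun B => ?_)
  · ext B
    change A 0 0 * B 0 0 + A 0 0 * B 0 0 + (A 1 0 * B 1 0 + A 1 0 * B 1 0) +
      (A 0 1 * B 0 1 + A 0 1 * B 0 1 + (A 1 1 * B 1 1 + A 1 1 * B 1 1)) = 2 * inn A B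
    rw [inn_eq_sum]
    ring
  · exact inn_eq_sum B B

lemma continuous_fnorm : Continuous fnorm :=
  Real.continuous_sqrt.comp
    (continuous_iff_continuousAt.2 fun A => (hasFDerivAt_inn_self A).continuousAt)

lemma hasFDerivAt_fnorm {A : M2} (hA : A ≠ 0) :
    HasFDerivAt fnorm ((fnorm A)⁻¹ • innL A) A := by
  refine ((hasFDerivAt_inn_self A).sqrt (inn_self_pos hA).ne').congr_fderiv ?_
  ext B
  change 1 / (2 * fnorm A) * (2 * inn A B) = (fnorm A)⁻¹ * inn A B
  have := (fnorm_pos hA).ne'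
  field_simp

lemma hasFDerivAt_fnorm_dev {ξ : M2} (hξ : dev ξ ≠ 0) :
    HasFDerivAt (fun x => fnorm (dev x)) (((fnorm (dev ξ))⁻¹ • innL (dev ξ)).comp devL) ξ := by
  have h := HasFDerivAt.comp ξ (hasFDerivAt_fnorm (A := devL ξ) (by simpa using hξ))
    devL.hasFDerivAt
  simp only [Function.comp_def, devL_apply] at h
  exact h

lemma continuous_fnorm_dev : Continuous fun x => fnorm (dev x) := by
  simpa [Function.comp_def] using continuous_fnorm.comp devL.continuous

lemma dev_smul_one (c : ℝ) : dev (c • (1 : M2)) = 0 := by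
  simp [dev, Matrix.trace_smul]

lemma fnorm_zero : fnorm (0 : M2) = 0 := by simp [fnorm, inn]

lemma eventually_mem_A1 {α lam mu : ℝ} {ξ : M2} (hξ : ξ ∈ A1 α lam mu) :
    ∀ᶠ x in nhdsWithin ξ Msym, x ∈ A1 α lam mu := by
  have hc : Continuous fun x : M2 => mu * fnorm (dev x) + α * (lam + mu) * traceL x :=
    (continuous_const.mul continuous_fnorm_dev).add (continuous_const.mul traceL.continuous)
  have h := hc.continuousAt.eventually_lt continuousAt_const hξ.2
  filter_upwards [self_mem_nhdsWithin, nhdsWithin_le_nhds h] with x hx hx' using ⟨hx, hx'⟩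

lemma eventually_mem_A2 {α : ℝ} {ξ : M2} (hξ : ξ ∈ A2 α) :
    ∀ᶠ x in nhdsWithin ξ Msym, x ∈ A2 α := by
  have hc : Continuous fun x : M2 => traceL x / (2 * α) := traceL.continuous.div_const _
  have h := continuous_fnorm_dev.continuousAt.eventually_lt hc.continuousAt hξ.2
  filter_upwards [self_mem_nhdsWithin, nhdsWithin_le_nhds h] with x hx hx' using ⟨hx, hx'⟩

lemma notMem_A1_of_mem_A2 {α lam mu : ℝ} (hα : 0 < α) (hmu : 0 < mu) (hlm : 0 < lam + mu)
    {ξ : M2} (hξ : ξ ∈ A2 α) : ξ ∉ A1 α lam mu := by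
  intro h
  have h0 := fnorm_nonneg (dev ξ)
  have ht : 0 < ξ.trace := by
    have := h0.trans_lt hξ.2
    rwa [div_pos_iff_of_pos_right (by positivity)] at this
  have := h.2
  have : 0 < α * (lam + mu) * ξ.trace := by positivity
  have : 0 ≤ mu * fnorm (dev ξ) := by positivity
  linarith

lemma smul_one_mem_A1 {α lam mu c : ℝ} (hα : 0 < α) (hlm : 0 < lam + mu) (hc : c < 0) :
    c • (1 : M2) ∈ A1 α lam mu := by
  refine ⟨Matrix.isSymm_one.smul c, ?_⟩
  have : 0 < α * (lam + mu) := by positivity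
  simp only [dev_smul_one, fnorm_zero, Matrix.trace_smul, Matrix.trace_one, smul_eq_mul]
  simp
  nlinarith

lemma smul_one_mem_A2 {α c : ℝ} (hα : 0 < α) (hc : 0 < c) : c • (1 : M2) ∈ A2 α := by
  refine ⟨Matrix.isSymm_one.smul c, ?_⟩
  simp only [dev_smul_one, fnorm_zero, Matrix.trace_smul, Matrix.trace_one, smul_eq_mul]
  simp
  positivity

lemma zero_mem_closure_A1 {α lam mu : ℝ} (hα : 0 < α) (hlm : 0 < lam + mu) :
    (0 : M2) ∈ closure (A1 α lam mu) := by
  have hc : Continuous fun c : ℝ => c • (1 : M2) := continuous_id.smul continuous_const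
  have h := hc.closure_preimage_subset (A1 α lam mu)
  have h0 : (0 : ℝ) ∈ closure (Iio (0 : ℝ)) := by simp
  simpa using h (closure_mono (fun c hc => smul_one_mem_A1 hα hlm hc) h0)

lemma dev_ne_zero_of_mem_A3 {α lam mu : ℝ} (hα : 0 < α) (hlm : 0 < lam + mu) {ξ : M2}
    (hξ : ξ ∈ A3 α lam mu) : dev ξ ≠ 0 := by
  intro h
  have hs : ξ = (ξ.trace / 2) • (1 : M2) := sub_eq_zero.1 h
  refine hξ.2 ?_
  rcases lt_trichotomy (ξ.trace / 2) 0 with hc | hc | hc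
  · exact .inl (subset_closure (hs ▸ smul_one_mem_A1 hα hlm hc))
  · rw [hc, zero_smul] at hs
    exact .inl (hs ▸ zero_mem_closure_A1 hα hlm)
  · exact .inr (subset_closure (hs ▸ smul_one_mem_A2 hα hc))

lemma eventually_notMem_of_mem_A3 {α lam mu : ℝ} (hα : 0 < α) (hlm : 0 < lam + mu) {ξ : M2}
    (hξ : ξ ∈ A3 α lam mu) :
    ∀ᶠ x in nhdsWithin ξ Msym, x ∉ A1 α lam mu ∧ ¬(x ∈ A2 α ∨ x = 0) := by
  have ho : IsOpen (closure (A1 α lam mu) ∪ closure (A2 α))ᶜ :=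
    (isClosed_closure.union isClosed_closure).isOpen_compl
  filter_upwards [nhdsWithin_le_nhds (ho.mem_nhds hξ.2)] with x hx
  refine ⟨fun h => hx (.inl (subset_closure h)), ?_⟩
  rintro (h | rfl)
  · exact hx (.inr (subset_closure h))
  · exact hx (.inl (zero_mem_closure_A1 hα hlm))

/-- For every `ξ ∈ 𝒜₁ ∪ 𝒜₂ ∪ 𝒜₃`, `G` is differentiable at `ξ` (within
`𝕄²ˣ²_sym`) and `DG(ξ)η = 𝒢(ξ,η)` for every `η`. -/
theorem stmt_13 (α κ lam mu : ℝ) (hα : 0 < α) (hκ : 0 < κ) (hmu : 0 < mu)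
    (hlm : 0 < lam + mu) (ξ : M2) (hξ : ξ ∈ A1 α lam mu ∪ A2 α ∪ A3 α lam mu) :
    ∃ L : M2 →L[ℝ] M2,
      HasFDerivWithinAt (Gfun α κ lam mu) L Msym ξ ∧
      ∀ η : M2, L η = calG α lam mu ξ η := by
  rcases hξ with (hξ | hξ) | hξ
  · refine ⟨((lam + mu) • traceL).smulRight (1 : M2) + (2 * mu) • devL, ?_, fun η => ?_⟩
    · have h := ((((lam + mu) • traceL).smulRight (1 : M2) + (2 * mu) • devL).hasFDerivAt
        (x := ξ)).const_add ((κ / (2 * α)) • (1 : M2))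
      refine (Filter.EventuallyEq.hasFDerivWithinAt_iff_of_mem (s := Msym) ?_ hξ.1).2 h.hasFDerivWithinAt
      filter_upwards [eventually_mem_A1 hξ] with x hx
      simp [Gfun, hx, add_assoc]
    · simp [calG, hξ]
  · refine ⟨0, ?_, fun η => ?_⟩
    · refine (Filter.EventuallyEq.hasFDerivWithinAt_iff_of_mem (s := Msym) ?_ hξ.1).2
        (hasFDerivWithinAt_const ((κ / (2 * α)) • (1 : M2)) ξ Msym)
      filter_upwards [eventually_mem_A2 hξ] with x hx
      simp [Gfun, hx, notMem_A1_of_mem_A2 hα hmu hlm hx]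
    · simp [calG, hξ, notMem_A1_of_mem_A2 hα hmu hlm hξ]
  · have hd := dev_ne_zero_of_mem_A3 hα hlm hξ
    have hev := eventually_notMem_of_mem_A3 hα hlm hξ
    have hn := (fnorm_pos hd).ne'
    have hN := hasFDerivAt_fnorm_dev hd
    have hT := (traceL.hasFDerivAt (x := ξ)).mul_const (2 * α)⁻¹
    have hI := (hasDerivAt_inv hn).comp_hasFDerivAt ξ hN
    have h := (((hN.sub hT).const_mul (2 * betaC α lam mu)).smul
      ((hI.smul (devL.hasFDerivAt (x := ξ))).sub_const
        ((1 / (2 * α)) • (1 : M2)))).const_add ((κ / (2 * α)) • (1 : M2))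
    refine ⟨_, (Filter.EventuallyEq.hasFDerivWithinAt_iff_of_mem (s := Msym) ?_ hξ.1).2
      h.hasFDerivWithinAt, fun η => ?_⟩
    · filter_upwards [hev] with x hx
      simp [Gfun, hx.1, hx.2, div_eq_mul_inv]
    · have hx := hev.self_of_nhdsWithin hξ.1
      rw [calG, if_neg hx.1, if_neg hx.2]
      change (2 * betaC α lam mu * (fnorm (dev ξ) - ξ.trace * (2 * α)⁻¹)) •
          ((fnorm (dev ξ))⁻¹ • devL η +
            (-(fnorm (dev ξ) ^ 2)⁻¹ * ((fnorm (dev ξ))⁻¹ * inn (dev ξ) (devL η))) • devL ξ) +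
        (2 * betaC α lam mu * ((fnorm (dev ξ))⁻¹ * inn (dev ξ) (devL η) -
          (2 * α)⁻¹ * η.trace)) •
          ((fnorm (dev ξ))⁻¹ • devL ξ - (1 / (2 * α)) • (1 : M2)) = _
      simp only [devL_apply, div_eq_mul_inv]
      module
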